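/- arXiv:1412.1515 — 2 statements merged into one kernel-verified Lean document; each statement's English description precedes it below -/
import Mathlib

section
/- Let (X, ≤) be a linearly ordered set equipped with the interval (order) topology. Then every bounded function f : X → ℝ of bounded variation is fragmented. -/
/-- A real-valued function on a topological space is fragmented. -/
def FragmentedR {X : Type*} [TopologicalSpace X] (f : X → ℝ) : Prop :=
  ∀ A : Set X, A.Nonempty → ∀ ε : ℝ, 0 < ε → ∃ O : Set X, IsOpen O ∧ (O ∩ A).Nonempty ∧
    ∀ x ∈ O ∩ A, ∀ y ∈ O ∩ A, |f x - f y| < ε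

/-- A function whose sums of increments along increasing sequences are bounded by `r` has total
variation at most `r`. -/
theorem eVariationOn_univ_le_ofReal {X : Type*} [LinearOrder X] {f : X → ℝ} {r : ℝ}
    (h : ∀ (n : ℕ) (x : ℕ → X), (∀ i, x i ≤ x (i + 1)) →
      ∑ i ∈ Finset.range n, |f (x (i + 1)) - f (x i)| ≤ r) :
    eVariationOn f Set.univ ≤ ENNReal.ofReal r := by
  refine iSup_le fun p ↦ ?_
  simp only [edist_dist, Real.dist_eq]
  rw [← ENNReal.ofReal_sum_of_nonneg fun i _ ↦ abs_nonneg _]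
  exact ENNReal.ofReal_le_ofReal (h p.1 p.2.1 fun i ↦ p.2.2.1 i.le_succ)

/-- On a linearly ordered space with the order topology, a function of finite total variation is
fragmented. -/
theorem fragmentedR_of_eVariationOn_ne_top {X : Type*} [LinearOrder X] [TopologicalSpace X]
    [OrderTopology X] {f : X → ℝ} (hf : eVariationOn f Set.univ ≠ ⊤) : FragmentedR f := by
  intro A hA ε hε
  by_contra! hfrag
  have exists_jump : ∀ O : Set X, IsOpen O → (O ∩ A).Nonempty →
      ∃ x ∈ O ∩ A, ∃ y ∈ O ∩ A, x < y ∧ ε ≤ |f x - f y| := by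
    intro O hO hOA
    obtain ⟨x, hx, y, hy, hxy⟩ := hfrag O hO hOA
    rcases lt_trichotomy x y with hlt | rfl | hlt
    · exact ⟨x, hx, y, hy, hlt, hxy⟩
    · simp only [sub_self, abs_zero] at hxy
      exact absurd hxy hε.not_ge
    · exact ⟨y, hy, x, hx, hlt, abs_sub_comm (f x) (f y) ▸ hxy⟩
  -- The infimum of the variations over nonempty relatively open subsets of `A`
  -- is positive and finite, yet at least twice itself.
  let m : ENNReal := ⨅ (O : Set X) (_ : IsOpen O ∧ (O ∩ A).Nonempty), eVariationOn f (O ∩ A)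
  have hm_le : ∀ O : Set X, IsOpen O → (O ∩ A).Nonempty → m ≤ eVariationOn f (O ∩ A) :=
    fun O hO hOA ↦ iInf₂_le O ⟨hO, hOA⟩
  have hm_pos : m ≠ 0 := by
    refine ((ENNReal.ofReal_pos.2 hε).trans_le (le_iInf₂ fun O hO ↦ ?_)).ne'
    obtain ⟨x, hx, y, hy, -, hxy⟩ := exists_jump O hO.1 hO.2
    refine le_trans ?_ (eVariationOn.edist_le f hx hy)
    rw [edist_dist, Real.dist_eq]
    exact ENNReal.ofReal_le_ofReal hxy
  have hm_top : m ≠ ⊤ :=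
    ne_top_of_le_ne_top hf ((hm_le Set.univ isOpen_univ (by simpa using hA)).trans
      (eVariationOn.mono f (Set.subset_univ _)))
  have hm_double : m + m ≤ m := by
    refine le_iInf₂ fun O hO ↦ ?_
    obtain ⟨x, hx, c, hc, hxc, -⟩ := exists_jump O hO.1 hO.2
    obtain ⟨a, ha, b, hb, hab, -⟩ := exists_jump (O ∩ Set.Iio c) (hO.1.inter isOpen_Iio)
      ⟨x, ⟨hx.1, hxc⟩, hx.2⟩
    calc m + m ≤ eVariationOn f (O ∩ Set.Iio b ∩ A) + eVariationOn f (O ∩ Set.Ioi b ∩ A) :=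
          add_le_add
            (hm_le _ (hO.1.inter isOpen_Iio) ⟨a, ⟨ha.1.1, hab⟩, ha.2⟩)
            (hm_le _ (hO.1.inter isOpen_Ioi) ⟨c, ⟨hc.1, hb.1.2⟩, hc.2⟩)
      _ ≤ eVariationOn f (O ∩ Set.Iio b ∩ A ∪ O ∩ Set.Ioi b ∩ A) :=
          eVariationOn.add_le_union f fun u hu v hv ↦ (lt_trans hu.1.2 hv.1.2).le
      _ ≤ eVariationOn f (O ∩ A) := eVariationOn.mono f <| Set.union_subset
          (Set.inter_subset_inter_left A Set.inter_subset_left)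
          (Set.inter_subset_inter_left A Set.inter_subset_left)
  exact (ENNReal.lt_add_right hm_top hm_pos).not_ge hm_double

/-- On a LOTS, every bounded function of bounded variation is fragmented. -/
theorem bv_is_fragmented {X : Type*} [LinearOrder X] [TopologicalSpace X]
    [OrderTopology X] (f : X → ℝ)
    (hb : ∃ M : ℝ, ∀ x, |f x| ≤ M)
    (hbv : ∃ r : ℝ, 0 < r ∧ ∀ (n : ℕ) (x : ℕ → X), (∀ i, x i ≤ x (i + 1)) →
      ∑ i ∈ Finset.range n, |f (x (i + 1)) - f (x i)| ≤ r) :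
    FragmentedR f := by
  obtain ⟨r, -, hr⟩ := hbv
  exact fragmentedR_of_eVariationOn_ne_top
    (ne_top_of_le_ne_top ENNReal.ofReal_ne_top (eVariationOn_univ_le_ofReal hr))
end

section
/- Let (X, ≤) be a linearly ordered set, (Y, d) a compact metric space, and r > 0. Let BV_r(X,Y) be the set of all functions f : X → Y such that Σ_{i=0}^{n-1} d(f(x_{i+1}), f(x_i)) ≤ r for every finite chain x_0 ≤ x_1 ≤ ⋯ ≤ x_n in X. Then BV_r(X,Y) is sequentially compact in the pointwise convergence topology: every sequence in BV_r(X,Y) has a subsequence converging pointwise on X to a function in BV_r(X,Y). -/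
open Filter Topology

/-- `f : X → Y` has variation at most `r`, where `Y` is a metric space. -/
def MetricVarLE {X : Type*} [LinearOrder X] {Y : Type*} [MetricSpace Y]
    (f : X → Y) (r : ℝ) : Prop :=
  ∀ (n : ℕ) (x : ℕ → X), (∀ i, x i ≤ x (i + 1)) →
    ∑ i ∈ Finset.range n, dist (f (x (i + 1))) (f (x i)) ≤ r

open scoped ENNReal

theorem MapClusterPt.exists_strictMono_tendsto_of_countable {α β : Type*} [TopologicalSpace β]
    [FirstCountableTopology β] {u : ℕ → α → β} {g : α → β} (hg : MapClusterPt g atTop u)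
    {s : Set α} (hs : s.Countable) :
    ∃ φ : ℕ → ℕ, StrictMono φ ∧ ∀ x ∈ s, Tendsto (fun k => u (φ k) x) atTop (𝓝 (g x)) := by
  have := hs.to_subtype
  have hcont : Continuous (fun (h : α → β) (x : s) => h x) := by fun_prop
  obtain ⟨φ, hφ, hlim⟩ := (hg.continuousAt_comp hcont.continuousAt).tendsto_subseq
  exact ⟨φ, hφ, fun x hx => (tendsto_pi_nhds.1 hlim) ⟨x, hx⟩⟩

theorem exists_mapClusterPt_of_compactSpace {β : Type*} [TopologicalSpace β] [CompactSpace β]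
    (u : ℕ → β) : ∃ g, MapClusterPt g atTop u :=
  exists_clusterPt_of_compactSpace _

/-- Monotone functions converging to a monotone function on a dense set containing the endpoints
converge at every continuity point of the limit. -/
theorem Monotone.tendsto_of_dense_of_continuousAt {α β ι : Type*} [LinearOrder α]
    [TopologicalSpace α] [OrderTopology α] [DenselyOrdered α] [LinearOrder β] [TopologicalSpace β]
    [OrderTopology β] {l : Filter ι} {u : ι → α → β} (hu : ∀ n, Monotone (u n)) {g : α → β}
    {s : Set α} (hs : Dense s) (hbot : ∀ x, IsBot x → x ∈ s) (htop : ∀ x, IsTop x → x ∈ s)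
    (hlim : ∀ x ∈ s, Tendsto (fun n => u n x) l (𝓝 (g x))) {x : α} (hx : ContinuousAt g x) :
    Tendsto (fun n => u n x) l (𝓝 (g x)) := by
  by_cases hxs : x ∈ s
  · exact hlim x hxs
  have hlt : ∃ a, a < x := by
    by_contra! h
    exact hxs (hbot x h)
  have hgt : ∃ b, x < b := by
    by_contra! h
    exact hxs (htop x h)
  refine tendsto_order.2 ⟨fun a ha => ?_, fun b hb => ?_⟩
  · obtain ⟨p, hp, hsub⟩ := exists_Ioc_subset_of_mem_nhds (hx.eventually (lt_mem_nhds ha)) hlt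
    obtain ⟨z, hzs, hz⟩ := hs.exists_between hp
    filter_upwards [(hlim z hzs).eventually (lt_mem_nhds (hsub ⟨hz.1, hz.2.le⟩))] with n hn
    exact hn.trans_le (hu n hz.2.le)
  · obtain ⟨p, hp, hsub⟩ := exists_Ico_subset_of_mem_nhds (hx.eventually (gt_mem_nhds hb)) hgt
    obtain ⟨z, hzs, hz⟩ := hs.exists_between hp
    filter_upwards [(hlim z hzs).eventually (gt_mem_nhds (hsub ⟨hz.1.le, hz.2⟩))] with n hn
    exact (hu n hz.1.le).trans_lt hn

/-- Helly's selection theorem for monotone functions on a second countable linear order. -/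
theorem exists_strictMono_tendsto_of_monotone {α β : Type*} [LinearOrder α]
    [TopologicalSpace α] [OrderTopology α] [SecondCountableTopology α] [DenselyOrdered α]
    [LinearOrder β] [TopologicalSpace β] [OrderTopology β] [SecondCountableTopology β]
    [CompactSpace β] {u : ℕ → α → β} (hu : ∀ n, Monotone (u n)) :
    ∃ φ : ℕ → ℕ, StrictMono φ ∧ ∃ g : α → β,
      ∀ x, Tendsto (fun k => u (φ k) x) atTop (𝓝 (g x)) := by
  obtain ⟨g, hg⟩ := exists_mapClusterPt_of_compactSpace u
  have hmono : Monotone g :=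
    (isClosed_monotone (α := β) (β := α)).mem_of_mapClusterPt hg (Eventually.of_forall hu)
  obtain ⟨s, hsc, hsd, hbot, htop⟩ := exists_countable_dense_bot_top α
  obtain ⟨φ, hφ, hlim⟩ := hg.exists_strictMono_tendsto_of_countable
    (hsc.union hmono.countable_not_continuousAt)
  refine ⟨φ, hφ, g, fun x => ?_⟩
  by_cases hx : ContinuousAt g x
  · exact Monotone.tendsto_of_dense_of_continuousAt (fun n => hu (φ n)) hsd hbot htop
      (fun y hy => hlim y (Or.inl hy)) hx
  · exact hlim x (Or.inr hx)

/-- A sequence of uniformly bounded monotone functions on a linear order factors through a single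
map to `ℝ≥0∞`. -/
theorem exists_monotone_factorization {X : Type*} [LinearOrder X] {v : ℕ → X → ℝ≥0∞}
    (hv : ∀ n, Monotone (v n)) {R : ℝ≥0∞} (hR : R ≠ ∞) (hbound : ∀ n x, v n x ≤ R) :
    ∃ (s : X → ℝ≥0∞) (w : ℕ → ℝ≥0∞ → ℝ≥0∞), (∀ n, Monotone (w n)) ∧
      ∀ n x, w n (s x) = v n x := by
  let c : ℕ → ℝ≥0∞ := fun n => 2⁻¹ ^ (n + 1)
  have hc0 : ∀ n, c n ≠ 0 := fun n => pow_ne_zero _ (by simp)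
  have hctop : ∀ n, c n ≠ ∞ := fun n => ENNReal.pow_ne_top (by simp)
  let s : X → ℝ≥0∞ := fun x => ∑' n, c n * v n x
  have hsum : ∀ x, s x ≠ ∞ := fun x => by
    have hle : s x ≤ (∑' n, c n) * R := by
      rw [← ENNReal.tsum_mul_right]
      exact ENNReal.tsum_le_tsum fun n => by gcongr; exact hbound n x
    refine ne_top_of_le_ne_top (ENNReal.mul_ne_top ?_ hR) hle
    simp [c, ENNReal.tsum_geometric_add_one, ENNReal.mul_eq_top]
  have hs : ∀ n x z, s z ≤ s x → v n z ≤ v n x := by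
    intro n x z hzx
    by_contra! hlt
    have hxz : x ≤ z := le_of_not_ge fun h => hlt.not_ge (hv n h)
    refine hzx.not_gt (ENNReal.tsum_lt_tsum (i := n) (hsum x) (fun m => ?_) ?_)
    · gcongr
      exact hv m hxz
    · exact (ENNReal.mul_lt_mul_iff_right (hc0 n) (hctop n)).2 hlt
  refine ⟨s, fun n t => ⨆ (z : X) (_ : s z ≤ t), v n z, fun n t t' ht => ?_, fun n x => ?_⟩
  · exact iSup_mono fun z => iSup_mono' fun h => ⟨h.trans ht, le_rfl⟩
  · exact le_antisymm (iSup₂_le fun z hz => hs n x z hz) (le_iSup₂_of_le x le_rfl le_rfl)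

/-- Helly's selection theorem for monotone functions on an arbitrary linear order. -/
theorem exists_strictMono_tendsto_of_monotone_of_le {X : Type*} [LinearOrder X]
    {v : ℕ → X → ℝ≥0∞} (hv : ∀ n, Monotone (v n)) {R : ℝ≥0∞} (hR : R ≠ ∞)
    (hbound : ∀ n x, v n x ≤ R) :
    ∃ φ : ℕ → ℕ, StrictMono φ ∧ ∃ g : X → ℝ≥0∞,
      ∀ x, Tendsto (fun k => v (φ k) x) atTop (𝓝 (g x)) := by
  obtain ⟨s, w, hw, hws⟩ := exists_monotone_factorization hv hR hbound
  obtain ⟨φ, hφ, g, hg⟩ := exists_strictMono_tendsto_of_monotone hw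
  exact ⟨φ, hφ, fun x => g (s x), fun x => by simpa only [hws] using hg (s x)⟩

theorem exists_countable_dense_image {X M : Type*} [PseudoMetricSpace M]
    [SecondCountableTopology M] (V : X → M) :
    ∃ E : Set X, E.Countable ∧ ∀ x, ∀ ε > 0, ∃ e ∈ E, dist (V x) (V e) < ε := by
  rcases isEmpty_or_nonempty X with _ | _
  · exact ⟨∅, Set.countable_empty, isEmptyElim⟩
  obtain ⟨t, htV, htc, hVt⟩ :=
    (TopologicalSpace.IsSeparable.of_separableSpace (Set.range V)).exists_countable_dense_subset
  have hpre : ∀ y ∈ t, ∃ x, V x = y := fun y hy => htV hy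
  choose! p hp using hpre
  refine ⟨p '' t, htc.image p, fun x ε hε => ?_⟩
  obtain ⟨y, hy, hxy⟩ := Metric.mem_closure_iff.1 (hVt ⟨x, rfl⟩) ε hε
  exact ⟨p y, ⟨y, hy, rfl⟩, by rwa [hp y hy]⟩

/-- If the functions `f n` are dominated by pointwise convergent real functions, then a subsequence
of `f` converges pointwise. -/
theorem exists_strictMono_tendsto_of_dist_le {X Y : Type*} [MetricSpace Y] [CompactSpace Y]
    {f : ℕ → X → Y} {V : ℕ → X → ℝ} {W : X → ℝ}
    (hfV : ∀ n x y, dist (f n x) (f n y) ≤ dist (V n x) (V n y))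
    (hV : ∀ x, Tendsto (fun n => V n x) atTop (𝓝 (W x))) :
    ∃ φ : ℕ → ℕ, StrictMono φ ∧ ∃ g : X → Y,
      ∀ x, Tendsto (fun k => f (φ k) x) atTop (𝓝 (g x)) := by
  obtain ⟨E, hEc, hE⟩ := exists_countable_dense_image W
  obtain ⟨h, hh⟩ := exists_mapClusterPt_of_compactSpace f
  obtain ⟨φ, hφ, hlim⟩ := hh.exists_strictMono_tendsto_of_countable hEc
  have hcauchy : ∀ x, CauchySeq fun k => f (φ k) x := by
    intro x
    refine Metric.cauchySeq_iff'.2 fun ε hε => ?_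
    obtain ⟨e, heE, he⟩ := hE x (ε / 4) (by positivity)
    have hdist : ∀ᶠ k in atTop, dist (V (φ k) x) (V (φ k) e) < ε / 4 :=
      (((hV x).comp hφ.tendsto_atTop).dist ((hV e).comp hφ.tendsto_atTop)).eventually
        (gt_mem_nhds he)
    have hfe : ∀ᶠ k in atTop, dist (f (φ k) e) (h e) < ε / 4 :=
      Metric.tendsto_nhds.1 (hlim e heE) _ (by positivity)
    obtain ⟨N, hN⟩ := eventually_atTop.1 (hdist.and hfe)
    have hclose : ∀ k ≥ N, dist (f (φ k) x) (h e) < ε / 2 := fun k hk => by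
      linarith [dist_triangle (f (φ k) x) (f (φ k) e) (h e), hfV (φ k) x e, (hN k hk).1,
        (hN k hk).2]
    refine ⟨N, fun k hk => ?_⟩
    linarith [dist_triangle_right (f (φ k) x) (f (φ N) x) (h e), hclose k hk, hclose N le_rfl]
  choose g hg using fun x => cauchySeq_tendsto_of_complete (hcauchy x)
  exact ⟨φ, hφ, g, hg⟩

theorem MetricVarLE.eVariationOn_le {X : Type*} [LinearOrder X] {Y : Type*} [MetricSpace Y]
    {f : X → Y} {r : ℝ} (hf : MetricVarLE f r) (s : Set X) :
    eVariationOn f s ≤ ENNReal.ofReal r := by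
  refine iSup_le fun ⟨n, u, hu, _⟩ => ?_
  simp only [edist_dist]
  rw [← ENNReal.ofReal_sum_of_nonneg fun _ _ => dist_nonneg]
  exact ENNReal.ofReal_le_ofReal (hf n u fun i => hu i.le_succ)

theorem BoundedVariationOn.dist_le_dist_eVariationOn_Iic {X : Type*} [LinearOrder X] {Y : Type*}
    [PseudoMetricSpace Y] {f : X → Y} (hf : BoundedVariationOn f Set.univ) (x y : X) :
    dist (f x) (f y) ≤
      dist (eVariationOn f (Set.Iic x)).toReal (eVariationOn f (Set.Iic y)).toReal := by
  wlog hxy : x ≤ y generalizing x y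
  · rw [dist_comm, dist_comm (ENNReal.toReal _)]
    exact this y x (le_of_not_ge hxy)
  have hfin : ∀ z, eVariationOn f (Set.Iic z) ≠ ∞ := fun z => hf.mono (Set.subset_univ _)
  have hle : eVariationOn f (Set.Iic x) + edist (f x) (f y) ≤ eVariationOn f (Set.Iic y) :=
    calc
      _ ≤ eVariationOn f (Set.Iic x) + eVariationOn f (Set.Icc x y) := by
        gcongr
        exact eVariationOn.edist_le f (Set.left_mem_Icc.2 hxy) (Set.right_mem_Icc.2 hxy)
      _ ≤ eVariationOn f (Set.Iic x ∪ Set.Icc x y) :=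
        eVariationOn.add_le_union f fun a ha b hb => ha.trans hb.1
      _ ≤ eVariationOn f (Set.Iic y) :=
        eVariationOn.mono f (Set.union_subset (Set.Iic_subset_Iic.2 hxy) Set.Icc_subset_Iic_self)
  have hreal := ENNReal.toReal_mono (hfin y) hle
  rw [ENNReal.toReal_add (hfin x) (edist_ne_top _ _), ← dist_edist] at hreal
  rw [dist_comm (ENNReal.toReal _), Real.dist_eq]
  exact (le_sub_iff_add_le'.2 hreal).trans (le_abs_self _)

theorem MetricVarLE.of_tendsto {X : Type*} [LinearOrder X] {Y : Type*} [MetricSpace Y] {ι : Type*}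
    {l : Filter ι} [l.NeBot] {f : ι → X → Y} {g : X → Y} {r : ℝ} (hf : ∀ i, MetricVarLE (f i) r)
    (hlim : ∀ x, Tendsto (fun i => f i x) l (𝓝 (g x))) : MetricVarLE g r := fun n x hx =>
  le_of_tendsto' (tendsto_finsetSum _ fun i _ => (hlim (x (i + 1))).dist (hlim (x i)))
    fun k => hf k n x hx

/-- Helly type theorem for maps of bounded variation into a compact metric space:
`BV_r(X,Y)` is sequentially compact in the pointwise convergence topology. -/
theorem bv_metric_sequentially_compact {X : Type*} [LinearOrder X]
    {Y : Type*} [MetricSpace Y] [CompactSpace Y] {r : ℝ} (hr : 0 < r)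
    (f : ℕ → X → Y) (hvar : ∀ n, MetricVarLE (f n) r) :
    ∃ φ : ℕ → ℕ, StrictMono φ ∧ ∃ g : X → Y, MetricVarLE g r ∧
      ∀ x, Tendsto (fun k => f (φ k) x) atTop (𝓝 (g x)) := by
  have hle : ∀ n x, eVariationOn (f n) (Set.Iic x) ≤ ENNReal.ofReal r :=
    fun n x => (hvar n).eVariationOn_le _
  obtain ⟨φ, hφ, W, hW⟩ := exists_strictMono_tendsto_of_monotone_of_le
    (v := fun n x => eVariationOn (f n) (Set.Iic x))
    (fun n x y hxy => eVariationOn.mono _ (Set.Iic_subset_Iic.2 hxy)) ENNReal.ofReal_ne_top hle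
  have hWtop : ∀ x, W x ≠ ∞ := fun x =>
    ne_top_of_le_ne_top ENNReal.ofReal_ne_top (le_of_tendsto' (hW x) fun k => hle (φ k) x)
  obtain ⟨ψ, hψ, g, hg⟩ := exists_strictMono_tendsto_of_dist_le (f := fun k => f (φ k))
    (fun k => BoundedVariationOn.dist_le_dist_eVariationOn_Iic
      (ne_top_of_le_ne_top ENNReal.ofReal_ne_top ((hvar (φ k)).eVariationOn_le _)))
    (fun x => (ENNReal.tendsto_toReal (hWtop x)).comp (hW x))
  exact ⟨φ ∘ ψ, hφ.comp hψ, g, .of_tendsto (fun k => hvar (φ (ψ k))) hg, hg⟩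
end
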